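/- arXiv:2403.03762 — 5 statements merged into one kernel-verified Lean document; each statement's English description precedes it below -/
import Mathlib

section
/- For every fixed h₀ ∈ ℝⁿ, every cost matrix C ∈ ℝ^{n×n}, and every ε > 0, the function h ↦ S(h) is convex on ℝⁿ (as an extended-real-valued function). -/
open scoped BigOperators

/-- The entropic optimal-transport objective ⟨C,M⟩ + ε D(M), where
D(M) = ∑ₖₗ (Mₖₗ log Mₖₗ − Mₖₗ + 1) (with 0·log 0 = 0, as `Real.log 0 = 0`). -/
noncomputable def otObj {n : ℕ} (C : Matrix (Fin n) (Fin n) ℝ) (ε : ℝ)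
    (M : Matrix (Fin n) (Fin n) ℝ) : ℝ :=
  (∑ k, ∑ l, C k l * M k l) + ε * ∑ k, ∑ l, (M k l * Real.log (M k l) - M k l + 1)

/-- The feasible set: M ≥ 0 entrywise, row sums M𝟙 = h₀², column sums Mᵀ𝟙 ≥ h². -/
def otFeas {n : ℕ} (h₀ h : Fin n → ℝ) : Set (Matrix (Fin n) (Fin n) ℝ) :=
  {M | (∀ k l, 0 ≤ M k l) ∧ (∀ k, ∑ l, M k l = (h₀ k) ^ 2) ∧ (∀ l, (h l) ^ 2 ≤ ∑ k, M k l)}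

/-- The entropic OT regularizer S(h), as an extended-real-valued function
(the infimum over an empty feasible set is +∞ = ⊤). -/
noncomputable def Sreg {n : ℕ} (C : Matrix (Fin n) (Fin n) ℝ) (ε : ℝ)
    (h₀ h : Fin n → ℝ) : EReal :=
  sInf ((fun M => ((otObj C ε M : ℝ) : EReal)) '' otFeas h₀ h)

/-- Every entry of a feasible plan is at most the corresponding row sum. -/
theorem otFeas_entry_le {n : ℕ} {h₀ h : Fin n → ℝ} {M : Matrix (Fin n) (Fin n) ℝ}
    (hM : M ∈ otFeas h₀ h) (k l : Fin n) : M k l ≤ (h₀ k) ^ 2 := by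
  rw [← hM.2.1 k]
  exact Finset.single_le_sum (f := fun l => M k l) (fun j _ => hM.1 k j) (Finset.mem_univ l)

/-- The objective is bounded below on the feasible set. -/
theorem otObj_lower_bound {n : ℕ} (C : Matrix (Fin n) (Fin n) ℝ) {ε : ℝ} (hε : 0 ≤ ε)
    {h₀ h : Fin n → ℝ} {M : Matrix (Fin n) (Fin n) ℝ} (hM : M ∈ otFeas h₀ h) :
    ∑ k, ∑ l, -(|C k l| * (h₀ k) ^ 2) ≤ otObj C ε M := by
  have hcost : ∑ k, ∑ l, -(|C k l| * (h₀ k) ^ 2) ≤ ∑ k, ∑ l, C k l * M k l := by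
    gcongr with k _ l _
    have hbound := mul_le_mul_of_nonneg_left (otFeas_entry_le hM k l) (abs_nonneg (C k l))
    have habs := mul_le_mul_of_nonneg_right (neg_abs_le (C k l)) (hM.1 k l)
    linarith
  have hent : 0 ≤ ∑ k, ∑ l, (M k l * Real.log (M k l) - M k l + 1) := by
    refine Finset.sum_nonneg fun k _ => Finset.sum_nonneg fun l _ => ?_
    have := Real.self_sub_one_le_mul_log (hM.1 k l)
    linarith
  have := mul_nonneg hε hent
  unfold otObj
  linarith

/-- The regularizer never takes the value `-∞`. -/
theorem Sreg_ne_bot {n : ℕ} (C : Matrix (Fin n) (Fin n) ℝ) {ε : ℝ} (hε : 0 ≤ ε)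
    (h₀ h : Fin n → ℝ) : Sreg C ε h₀ h ≠ ⊥ := by
  refine ne_bot_of_le_ne_bot (EReal.coe_ne_bot (∑ k, ∑ l, -(|C k l| * (h₀ k) ^ 2))) ?_
  refine le_sInf ?_
  rintro _ ⟨M, hM, rfl⟩
  exact EReal.coe_le_coe_iff.2 (otObj_lower_bound C hε hM)

/-- Convex combinations of feasible plans are feasible for the combined parameter. -/
theorem otFeas_combo {n : ℕ} {h₀ h₁ h₂ : Fin n → ℝ} {M₁ M₂ : Matrix (Fin n) (Fin n) ℝ}
    (hM₁ : M₁ ∈ otFeas h₀ h₁) (hM₂ : M₂ ∈ otFeas h₀ h₂) {a b : ℝ} (ha : 0 ≤ a) (hb : 0 ≤ b)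
    (hab : a + b = 1) : a • M₁ + b • M₂ ∈ otFeas h₀ (a • h₁ + b • h₂) := by
  refine ⟨fun k l => ?_, fun k => ?_, fun l => ?_⟩
  · have := hM₁.1 k l
    have := hM₂.1 k l
    simp only [Matrix.add_apply, Matrix.smul_apply, smul_eq_mul]
    positivity
  · simp only [Matrix.add_apply, Matrix.smul_apply, smul_eq_mul, Finset.sum_add_distrib,
      ← Finset.mul_sum, hM₁.2.1 k, hM₂.2.1 k]
    rw [← add_mul, hab, one_mul]
  · simp only [Matrix.add_apply, Matrix.smul_apply, smul_eq_mul, Finset.sum_add_distrib,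
      ← Finset.mul_sum, Pi.add_apply, Pi.smul_apply]
    calc (a * h₁ l + b * h₂ l) ^ 2 ≤ a * h₁ l ^ 2 + b * h₂ l ^ 2 := by
          simpa using (even_two.convexOn_pow (𝕜 := ℝ)).2 (Set.mem_univ (h₁ l))
            (Set.mem_univ (h₂ l)) ha hb hab
      _ ≤ _ := by
          gcongr
          · exact hM₁.2.2 l
          · exact hM₂.2.2 l

/-- The objective is convex on entrywise nonnegative matrices. -/
theorem otObj_combo_le {n : ℕ} (C : Matrix (Fin n) (Fin n) ℝ) {ε : ℝ} (hε : 0 ≤ ε)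
    {M₁ M₂ : Matrix (Fin n) (Fin n) ℝ} (hM₁ : ∀ k l, 0 ≤ M₁ k l) (hM₂ : ∀ k l, 0 ≤ M₂ k l)
    {a b : ℝ} (ha : 0 ≤ a) (hb : 0 ≤ b) (hab : a + b = 1) :
    otObj C ε (a • M₁ + b • M₂) ≤ a * otObj C ε M₁ + b * otObj C ε M₂ := by
  have hsum : ∀ M, otObj C ε M =
      ∑ k, ∑ l, (C k l * M k l + ε * (M k l * Real.log (M k l) - M k l + 1)) := fun M => by
    simp only [otObj, Finset.mul_sum, ← Finset.sum_add_distrib]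
  rw [hsum, hsum, hsum]
  simp only [Finset.mul_sum, ← Finset.sum_add_distrib]
  refine Finset.sum_le_sum fun k _ => Finset.sum_le_sum fun l _ => ?_
  have hconv := Real.convexOn_mul_log.2 (Set.mem_Ici.2 (hM₁ k l)) (Set.mem_Ici.2 (hM₂ k l))
    ha hb hab
  have := mul_le_mul_of_nonneg_left hconv hε
  simp only [Matrix.add_apply, Matrix.smul_apply, smul_eq_mul] at this ⊢
  linear_combination this - ε * hab

/-- A value above `a * S(h)` is exceeded below by `a` times the objective of a feasible plan. -/
theorem exists_mul_otObj_lt {n : ℕ} {C : Matrix (Fin n) (Fin n) ℝ} {ε : ℝ} {h₀ h : Fin n → ℝ}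
    {a : ℝ} (ha : 0 < a) {x : EReal} (hx : (a : EReal) * Sreg C ε h₀ h < x) :
    ∃ M ∈ otFeas h₀ h, ((a * otObj C ε M : ℝ) : EReal) < x := by
  have ha' : (0 : EReal) < a := EReal.coe_pos.2 ha
  rw [mul_comm, ← EReal.lt_div_iff ha' (EReal.coe_ne_top a)] at hx
  obtain ⟨_, ⟨M, hM, rfl⟩, hlt⟩ := sInf_lt_iff.1 hx
  refine ⟨M, hM, ?_⟩
  rw [EReal.lt_div_iff ha' (EReal.coe_ne_top a)] at hlt
  rwa [mul_comm, EReal.coe_mul]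

/-- Scaling by a positive real keeps the regularizer away from `-∞`. -/
theorem mul_Sreg_ne_bot {n : ℕ} (C : Matrix (Fin n) (Fin n) ℝ) {ε : ℝ} (hε : 0 ≤ ε)
    (h₀ h : Fin n → ℝ) {a : ℝ} (ha : 0 < a) : (a : EReal) * Sreg C ε h₀ h ≠ ⊥ := by
  have := Sreg_ne_bot C hε h₀ h
  rw [EReal.mul_ne_bot]
  simp [this, ha.le, EReal.coe_nonneg]

/-- For fixed h₀, C and ε > 0, the function h ↦ S(h) is convex on ℝⁿ
(as an extended-real-valued function). -/
theorem stmt0 {n : ℕ} (h₀ : Fin n → ℝ) (C : Matrix (Fin n) (Fin n) ℝ)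
    (ε : ℝ) (hε : 0 < ε) :
    ∀ h₁ h₂ : Fin n → ℝ, ∀ a b : ℝ, 0 ≤ a → 0 ≤ b → a + b = 1 →
      Sreg C ε h₀ (a • h₁ + b • h₂) ≤
        (a : EReal) * Sreg C ε h₀ h₁ + (b : EReal) * Sreg C ε h₀ h₂ := by
  intro h₁ h₂ a b ha hb hab
  rcases ha.eq_or_lt with rfl | ha
  · obtain rfl : b = 1 := by linarith
    simp
  rcases hb.eq_or_lt with rfl | hb
  · obtain rfl : a = 1 := by linarith
    simp
  refine EReal.le_add_of_forall_gt (.inl (mul_Sreg_ne_bot C hε.le h₀ h₁ ha))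
    (.inr (mul_Sreg_ne_bot C hε.le h₀ h₂ hb)) fun x hx y hy => ?_
  obtain ⟨M₁, hM₁, hlt₁⟩ := exists_mul_otObj_lt ha hx
  obtain ⟨M₂, hM₂, hlt₂⟩ := exists_mul_otObj_lt hb hy
  calc Sreg C ε h₀ (a • h₁ + b • h₂) ≤ (otObj C ε (a • M₁ + b • M₂) : EReal) :=
        sInf_le ⟨_, otFeas_combo hM₁ hM₂ ha.le hb.le hab, rfl⟩
    _ ≤ ((a * otObj C ε M₁ + b * otObj C ε M₂ : ℝ) : EReal) :=
        EReal.coe_le_coe_iff.2 (otObj_combo_le C hε.le hM₁.1 hM₂.1 ha.le hb.le hab)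
    _ ≤ x + y := by
        rw [EReal.coe_add]
        exact add_le_add hlt₁.le hlt₂.le
end

section
/- For h, h₀ ∈ ℝⁿ, the feasible set {M ∈ ℝ^{n×n} : M ≥ 0 entrywise, M𝟙 = h₀², Mᵀ𝟙 ≥ h² entrywise} is nonempty if and only if ∑ᵢ hᵢ² ≤ ∑ᵢ (h₀)ᵢ². -/
open scoped BigOperators

/-- The feasible set is nonempty iff ∑ᵢ hᵢ² ≤ ∑ᵢ (h₀)ᵢ². -/
theorem stmt1 {n : ℕ} (h h₀ : Fin n → ℝ) :
    (otFeas h₀ h).Nonempty ↔ ∑ i, (h i) ^ 2 ≤ ∑ i, (h₀ i) ^ 2 := by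
  constructor
  · rintro ⟨M, -, hrow, hcol⟩
    calc ∑ l, (h l) ^ 2 ≤ ∑ l, ∑ k, M k l := Finset.sum_le_sum fun l _ => hcol l
      _ = ∑ k, ∑ l, M k l := Finset.sum_comm
      _ = ∑ k, (h₀ k) ^ 2 := Finset.sum_congr rfl fun k _ => hrow k
  · intro hle
    have hnonneg : 0 ≤ ∑ i, (h i) ^ 2 := Finset.sum_nonneg fun i _ => sq_nonneg _
    rcases hnonneg.eq_or_lt with hzero | hpos
    · have hvanish : ∀ l, (h l) ^ 2 = 0 := fun l =>
        (Finset.sum_eq_zero_iff_of_nonneg fun i _ => sq_nonneg (h i)).1 hzero.symm l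
          (Finset.mem_univ l)
      refine ⟨Matrix.diagonal fun k => (h₀ k) ^ 2, fun k l => ?_, fun k => ?_, fun l => ?_⟩
      · rw [Matrix.diagonal_apply]
        split_ifs <;> positivity
      · simp [Matrix.diagonal_apply]
      · simp [Matrix.diagonal_apply, hvanish l, sq_nonneg]
    · refine ⟨fun k l => (h₀ k) ^ 2 * ((h l) ^ 2 / ∑ i, (h i) ^ 2), fun k l => by positivity,
        fun k => ?_, fun l => ?_⟩
      · rw [← Finset.mul_sum, ← Finset.sum_div, div_self hpos.ne', mul_one]
      · rw [← Finset.sum_mul, ← mul_div_assoc, le_div_iff₀ hpos, mul_comm]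
        exact mul_le_mul_of_nonneg_right hle (sq_nonneg _)
end

section
/- Let q > 0, u ∈ ℝ with u ≠ 0, and θ, ε > 0, and let μ₀ ∈ (−1/2, ∞) be the unique real with q · exp(μ₀/(θ ε)) · (1 + 2μ₀)² = u². Then the function f(μ) = θ ε q exp(μ/(θ ε)) − u² · μ/(1 + 2μ) attains its minimum over [0, ∞) at the unique point μ* = max(0, μ₀). -/
/-- A point `m ≥ 0` satisfying the first-order optimality conditions on `[0, ∞)` is the strict
global minimizer there of the function `k q exp(x/k) - c x/(1 + 2x)`. -/
theorem exp_sub_div_lt_of_first_order {q c k m x : ℝ} (hq : 0 < q) (hk : 0 < k)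
    (hm : 0 ≤ m) (hle : c ≤ q * Real.exp (m / k) * (1 + 2 * m) ^ 2)
    (heq : 0 < m → q * Real.exp (m / k) * (1 + 2 * m) ^ 2 = c) (hx : 0 ≤ x) (hne : x ≠ m) :
    k * q * Real.exp (m / k) - c * (m / (1 + 2 * m))
      < k * q * Real.exp (x / k) - c * (x / (1 + 2 * x)) := by
  have hexp : q * Real.exp (m / k) * (x - m)
      < k * q * Real.exp (x / k) - k * q * Real.exp (m / k) := by
    have h0 : (x - m) / k ≠ 0 := div_ne_zero (sub_ne_zero.mpr hne) hk.ne'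
    have hmul := mul_lt_mul_of_pos_left (Real.add_one_lt_exp h0)
      (mul_pos (mul_pos hk hq) (Real.exp_pos (m / k)))
    have hsplit : Real.exp (x / k) = Real.exp (m / k) * Real.exp ((x - m) / k) := by
      rw [← Real.exp_add]
      congr 1
      ring
    have hlin : k * q * Real.exp (m / k) * ((x - m) / k + 1)
        = q * Real.exp (m / k) * (x - m) + k * q * Real.exp (m / k) := by
      field_simp
    rw [hsplit]
    linarith
  have hA : 0 < q * Real.exp (m / k) := mul_pos hq (Real.exp_pos _)
  have hfrac : c * (x / (1 + 2 * x)) - c * (m / (1 + 2 * m))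
      ≤ q * Real.exp (m / k) * (x - m) := by
    generalize q * Real.exp (m / k) = A at *
    have hdiff : c * (x / (1 + 2 * x)) - c * (m / (1 + 2 * m))
        = c * (x - m) / ((1 + 2 * x) * (1 + 2 * m)) := by
      field_simp
      ring
    rw [hdiff, div_le_iff₀ (by positivity)]
    have hquad : 0 ≤ A * (1 + 2 * m) * (2 * (x - m) ^ 2) := by positivity
    rcases hm.eq_or_lt with rfl | hpos
    · nlinarith [mul_nonneg (sub_nonneg.mpr hle) hx]
    · rw [← heq hpos]
      linarith
  linarith

/-- For q > 0, u ≠ 0, θ, ε > 0, with μ₀ ∈ (−1/2, ∞) the unique root of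
q exp(μ₀/(θε)) (1 + 2μ₀)² = u², the function
f(μ) = θ ε q exp(μ/(θε)) − u² μ/(1 + 2μ) attains its minimum over [0, ∞) at
the unique point μ* = max(0, μ₀). -/
theorem stmt12 (q u θ ε μ₀ : ℝ) (hq : 0 < q) (hu : u ≠ 0) (hθ : 0 < θ) (hε : 0 < ε)
    (hμ₀ : -(1 / 2) < μ₀)
    (hroot : q * Real.exp (μ₀ / (θ * ε)) * (1 + 2 * μ₀) ^ 2 = u ^ 2) :
    (∀ μ : ℝ, 0 ≤ μ →
        θ * ε * q * Real.exp (max 0 μ₀ / (θ * ε)) - u ^ 2 * (max 0 μ₀ / (1 + 2 * max 0 μ₀))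
          ≤ θ * ε * q * Real.exp (μ / (θ * ε)) - u ^ 2 * (μ / (1 + 2 * μ))) ∧
    (∀ μ : ℝ, 0 ≤ μ →
        θ * ε * q * Real.exp (μ / (θ * ε)) - u ^ 2 * (μ / (1 + 2 * μ))
          = θ * ε * q * Real.exp (max 0 μ₀ / (θ * ε)) - u ^ 2 * (max 0 μ₀ / (1 + 2 * max 0 μ₀))
          → μ = max 0 μ₀) := by
  have hk : 0 < θ * ε := mul_pos hθ hε
  have hle : u ^ 2 ≤ q * Real.exp (max 0 μ₀ / (θ * ε)) * (1 + 2 * max 0 μ₀) ^ 2 := by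
    rw [← hroot]
    have hmax : μ₀ ≤ max 0 μ₀ := le_max_right _ _
    have hpos : 0 ≤ 1 + 2 * μ₀ := by linarith
    gcongr
  have heq : 0 < max 0 μ₀ →
      q * Real.exp (max 0 μ₀ / (θ * ε)) * (1 + 2 * max 0 μ₀) ^ 2 = u ^ 2 := by
    intro h
    have hμ₀pos : 0 < μ₀ := by simpa using h
    rwa [max_eq_right hμ₀pos.le]
  have hlt := fun (μ : ℝ) (hμ : 0 ≤ μ) (hne : μ ≠ max 0 μ₀) ↦
    exp_sub_div_lt_of_first_order hq hk (le_max_left 0 μ₀) hle heq hμ hne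
  refine ⟨fun μ hμ ↦ ?_, fun μ hμ h ↦ ?_⟩
  · rcases eq_or_ne μ (max 0 μ₀) with rfl | hne
    · exact le_rfl
    · exact (hlt μ hμ hne).le
  · by_contra hne
    exact (hlt μ hμ hne).ne' h
end

section
/- Let u, h₀ ∈ ℝⁿ, C ∈ ℝ^{n×n}, θ, ε > 0, and let λ ∈ ℝⁿ and μ ∈ ℝⁿ with μ ≥ 0 entrywise. Define the Lagrangian L(M, h) = θ⟨C,M⟩ + θεD(M) + ⟨λ, h₀² − M𝟙⟩ + ⟨μ, h² − Mᵀ𝟙⟩ + (1/2)‖u − h‖₂² for h ∈ ℝⁿ and entrywise-nonnegative M ∈ ℝ^{n×n}. Then the infimum of L over all such (M, h) equals ⟨λ, h₀²⟩ + ∑ᵢ uᵢ² μᵢ/(1 + 2μᵢ) + θε(n² − vᵀK w), where vₖ = exp(λₖ/(θε)), w_ℓ = exp(μ_ℓ/(θε)), and K_{kℓ} = exp(−C_{kℓ}/ε); moreover this infimum is attained at hᵢ = uᵢ/(1 + 2μᵢ) and M_{kℓ} = vₖ K_{kℓ} w_ℓ. -/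
open scoped BigOperators

/-- The Lagrangian L(M, h) = θ⟨C,M⟩ + θεD(M) + ⟨λ, h₀² − M𝟙⟩ + ⟨μ, h² − Mᵀ𝟙⟩
+ (1/2)‖u − h‖₂², where D(M) = ∑ₖₗ (Mₖₗ log Mₖₗ − Mₖₗ + 1) (with 0·log 0 = 0,
as `Real.log 0 = 0`). -/
noncomputable def lagr {n : ℕ} (C : Matrix (Fin n) (Fin n) ℝ) (θ ε : ℝ)
    (u h₀ lam mu : Fin n → ℝ) (M : Matrix (Fin n) (Fin n) ℝ) (h : Fin n → ℝ) : ℝ :=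
  θ * (∑ k, ∑ l, C k l * M k l)
    + θ * ε * (∑ k, ∑ l, (M k l * Real.log (M k l) - M k l + 1))
    + (∑ i, lam i * ((h₀ i) ^ 2 - ∑ l, M i l))
    + (∑ i, mu i * ((h i) ^ 2 - ∑ k, M k i))
    + (1 / 2) * ∑ i, (u i - h i) ^ 2

/-- The Fenchel-Young inequality for the entropy `x log x - x` and its conjugate `exp`. -/
theorem mul_le_mul_log_sub_add_exp {x : ℝ} (hx : 0 ≤ x) (a : ℝ) :
    x * a ≤ x * Real.log x - x + Real.exp a := by
  rcases hx.eq_or_lt with rfl | hx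
  · simpa using (Real.exp_pos a).le
  · have h := mul_le_mul_of_nonneg_left (Real.add_one_le_exp (a - Real.log x)) hx.le
    rw [Real.exp_sub, Real.exp_log hx, mul_div_cancel₀ _ hx.ne'] at h
    linarith

theorem lagr_eq_sum_separable {n : ℕ} (C : Matrix (Fin n) (Fin n) ℝ) (θ ε : ℝ)
    (u h₀ lam mu : Fin n → ℝ) (M : Matrix (Fin n) (Fin n) ℝ) (h : Fin n → ℝ) :
    lagr C θ ε u h₀ lam mu M h = (∑ i, lam i * (h₀ i) ^ 2)
      + (∑ i, (mu i * (h i) ^ 2 + 1 / 2 * (u i - h i) ^ 2))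
      + ∑ k, ∑ l, (θ * (C k l * M k l)
          + θ * ε * (M k l * Real.log (M k l) - M k l + 1)
          - lam k * M k l - mu l * M k l) := by
  have hcol : ∑ i, ∑ k, mu i * M k i = ∑ k, ∑ l, mu l * M k l := Finset.sum_comm
  simp only [lagr, mul_sub, Finset.sum_sub_distrib, Finset.sum_add_distrib, Finset.mul_sum, hcol,
    mul_add]
  ring

theorem dual_value_eq_sum_separable {n : ℕ} (a c : ℝ) (b : Fin n → ℝ)
    (Y : Fin n → Fin n → ℝ) :
    a + (∑ i, b i) + c * ((n : ℝ) ^ 2 - ∑ k, ∑ l, Y k l)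
      = a + (∑ i, b i) + ∑ k, ∑ l, c * (1 - Y k l) := by
  simp only [← Finset.mul_sum, Finset.sum_sub_distrib]
  simp [sq]

theorem exp_mul_exp_mul_exp_eq (p q c θ ε : ℝ) (hθ : 0 < θ) (hε : 0 < ε) :
    Real.exp (p / (θ * ε)) * Real.exp (-c / ε) * Real.exp (q / (θ * ε))
      = Real.exp ((p + q - θ * c) / (θ * ε)) := by
  rw [← Real.exp_add, ← Real.exp_add]
  congr 1
  field_simp
  ring

/-- The infimum of the Lagrangian over h ∈ ℝⁿ and entrywise-nonnegative M equals
⟨λ, h₀²⟩ + ∑ᵢ uᵢ² μᵢ/(1 + 2μᵢ) + θε(n² − vᵀK w), with vₖ = exp(λₖ/(θε)),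
w_ℓ = exp(μ_ℓ/(θε)), K_{kℓ} = exp(−C_{kℓ}/ε); moreover it is attained at
hᵢ = uᵢ/(1 + 2μᵢ) and M_{kℓ} = vₖ K_{kℓ} w_ℓ. -/
theorem stmt14 {n : ℕ} (u h₀ : Fin n → ℝ) (C : Matrix (Fin n) (Fin n) ℝ)
    (θ ε : ℝ) (hθ : 0 < θ) (hε : 0 < ε)
    (lam mu : Fin n → ℝ) (hmu : ∀ i, 0 ≤ mu i) :
    lagr C θ ε u h₀ lam mu
        (fun k l => Real.exp (lam k / (θ * ε)) * Real.exp (-(C k l) / ε)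
          * Real.exp (mu l / (θ * ε)))
        (fun i => u i / (1 + 2 * mu i))
      = (∑ i, lam i * (h₀ i) ^ 2) + (∑ i, (u i) ^ 2 * (mu i / (1 + 2 * mu i)))
        + θ * ε * ((n : ℝ) ^ 2
          - ∑ k, ∑ l, Real.exp (lam k / (θ * ε)) * Real.exp (-(C k l) / ε)
              * Real.exp (mu l / (θ * ε))) ∧
    ∀ (M : Matrix (Fin n) (Fin n) ℝ) (h : Fin n → ℝ), (∀ k l, 0 ≤ M k l) →
      (∑ i, lam i * (h₀ i) ^ 2) + (∑ i, (u i) ^ 2 * (mu i / (1 + 2 * mu i)))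
        + θ * ε * ((n : ℝ) ^ 2
          - ∑ k, ∑ l, Real.exp (lam k / (θ * ε)) * Real.exp (-(C k l) / ε)
              * Real.exp (mu l / (θ * ε)))
        ≤ lagr C θ ε u h₀ lam mu M h := by
  rw [dual_value_eq_sum_separable]
  simp only [exp_mul_exp_mul_exp_eq _ _ _ θ ε hθ hε]
  refine ⟨?_, fun M h hM => ?_⟩
  · refine (lagr_eq_sum_separable C θ ε u h₀ lam mu _ _).trans ?_
    congr 1
    · congr 1
      refine Finset.sum_congr rfl fun i _ => ?_
      have hi : 1 + 2 * mu i ≠ 0 := by linarith [hmu i]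
      rw [show u i - u i / (1 + 2 * mu i) = 2 * mu i * u i / (1 + 2 * mu i) by
        field_simp; ring]
      field_simp
    · refine Finset.sum_congr rfl fun k _ => Finset.sum_congr rfl fun l _ => ?_
      simp only [Real.log_exp]
      field_simp
      ring
  · rw [lagr_eq_sum_separable]
    refine add_le_add (add_le_add le_rfl (Finset.sum_le_sum fun i _ => ?_))
      (Finset.sum_le_sum fun k _ => Finset.sum_le_sum fun l _ => ?_)
    · have hi : 0 < 1 + 2 * mu i := by linarith [hmu i]
      rw [← mul_div_assoc, div_le_iff₀ hi]
      nlinarith [sq_nonneg (u i - (1 + 2 * mu i) * h i)]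
    · have hθε : 0 < θ * ε := mul_pos hθ hε
      have key := mul_le_mul_of_nonneg_left
        (mul_le_mul_log_sub_add_exp (hM k l) ((lam k + mu l - θ * C k l) / (θ * ε))) hθε.le
      have hcancel : θ * ε * (M k l * ((lam k + mu l - θ * C k l) / (θ * ε)))
          = M k l * (lam k + mu l - θ * C k l) := by
        field_simp
      rw [hcancel] at key
      linarith
end

section
/- Let u, h₀ ∈ ℝⁿ, C ∈ ℝ^{n×n}, θ, ε > 0. Suppose λ ∈ ℝⁿ and μ ∈ ℝⁿ with μ ≥ 0 entrywise are such that, with vₖ = exp(λₖ/(θε)), w_ℓ = exp(μ_ℓ/(θε)), K_{kℓ} = exp(−C_{kℓ}/ε), M*_{kℓ} = vₖ K_{kℓ} w_ℓ, and h*ᵢ = uᵢ/(1 + 2μᵢ), the following hold: M*𝟙 = h₀², M*ᵀ𝟙 ≥ (h*)² entrywise, and ⟨μ, (h*)² − M*ᵀ𝟙⟩ = 0. Then h* is a global minimizer over ℝⁿ of the function h ↦ θ S(h) + (1/2)‖u − h‖₂², where S(h) = inf{⟨C,M⟩ + ε D(M) : M ≥ 0 entrywise, M𝟙 = h₀²,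 Mᵀ𝟙 ≥ h² entrywise}. -/
open scoped BigOperators

/-- The tangent-line inequality for the convex function `x ↦ x log x - x` at a positive point. -/
theorem mul_log_sub_tangent_le {x y : ℝ} (hx : 0 ≤ x) (hy : 0 < y) :
    y * Real.log y - y + (x - y) * Real.log y ≤ x * Real.log x - x := by
  rcases hx.eq_or_lt with rfl | hx
  · simp only [Real.log_zero]
    linarith
  · have h := Real.log_le_sub_one_of_pos (div_pos hy hx)
    rw [Real.log_div hy.ne' hx.ne'] at h
    have h2 := mul_le_mul_of_nonneg_left h hx.le
    have h3 : x * (y / x - 1) = y - x := by field_simp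
    linarith

/-- Lower bound for the entropic objective at a matrix `M` with the same row sums as a Gibbs-type
matrix `N`, in terms of the dual variables defining `N`. -/
theorem otObj_add_le {n : ℕ} {C M N : Matrix (Fin n) (Fin n) ℝ} {ε : ℝ} (hε : 0 < ε)
    (a b : Fin n → ℝ) (hN : ∀ k l, 0 < N k l)
    (hlog : ∀ k l, C k l + ε * Real.log (N k l) = a k + b l)
    (hM : ∀ k l, 0 ≤ M k l) (hrow : ∀ k, ∑ l, M k l = ∑ l, N k l) :
    otObj C ε N + ∑ l, b l * (∑ k, M k l - ∑ k, N k l) ≤ otObj C ε M := by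
  have hb : ∑ l, b l * (∑ k, M k l - ∑ k, N k l) = ∑ k, ∑ l, (a k + b l) * (M k l - N k l) := by
    have ha : ∑ k, ∑ l, a k * (M k l - N k l) = 0 := by
      refine Finset.sum_eq_zero fun k _ => ?_
      rw [← Finset.mul_sum, Finset.sum_sub_distrib, hrow, sub_self, mul_zero]
    simp only [add_mul, Finset.sum_add_distrib]
    rw [ha, zero_add, Finset.sum_comm]
    simp only [← Finset.sum_sub_distrib, Finset.mul_sum]
  rw [hb]
  simp only [otObj, Finset.mul_sum, ← Finset.sum_add_distrib]
  refine Finset.sum_le_sum fun k _ => Finset.sum_le_sum fun l _ => ?_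
  rw [← hlog]
  have h := mul_le_mul_of_nonneg_left (mul_log_sub_tangent_le (hM k l) (hN k l)) hε.le
  linarith

/-- The point `u / (1 + 2m)` minimizes `x ↦ m x² + (u - x)² / 2`. -/
theorem penalized_sq_le {m : ℝ} (hm : 0 ≤ m) (u x : ℝ) :
    m * (u / (1 + 2 * m)) ^ 2 + 1 / 2 * (u - u / (1 + 2 * m)) ^ 2
      ≤ m * x ^ 2 + 1 / 2 * (u - x) ^ 2 := by
  have hpos : 0 < 1 + 2 * m := by linarith
  obtain ⟨y, hy⟩ : ∃ y, y = u / (1 + 2 * m) := ⟨_, rfl⟩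
  have hu : u = (1 + 2 * m) * y := by rw [hy]; field_simp
  rw [← hy, hu]
  linarith [mul_nonneg hpos.le (sq_nonneg (x - y))]

/-- KKT-type sufficiency: if M*_{kℓ} = vₖ K_{kℓ} w_ℓ (with vₖ = exp(λₖ/(θε)),
w_ℓ = exp(μ_ℓ/(θε)), K_{kℓ} = exp(−C_{kℓ}/ε)) and h*ᵢ = uᵢ/(1 + 2μᵢ) satisfy
primal feasibility M*𝟙 = h₀², M*ᵀ𝟙 ≥ (h*)² and complementary slackness
⟨μ, (h*)² − M*ᵀ𝟙⟩ = 0, then h* globally minimizes h ↦ θ S(h) + (1/2)‖u − h‖₂². -/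
theorem stmt15 {n : ℕ} (u h₀ : Fin n → ℝ) (C : Matrix (Fin n) (Fin n) ℝ)
    (θ ε : ℝ) (hθ : 0 < θ) (hε : 0 < ε)
    (lam mu : Fin n → ℝ) (hmu : ∀ i, 0 ≤ mu i)
    (hrow : ∀ k, (∑ l, Real.exp (lam k / (θ * ε)) * Real.exp (-(C k l) / ε)
        * Real.exp (mu l / (θ * ε))) = (h₀ k) ^ 2)
    (hcol : ∀ l, (u l / (1 + 2 * mu l)) ^ 2
        ≤ ∑ k, Real.exp (lam k / (θ * ε)) * Real.exp (-(C k l) / ε)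
            * Real.exp (mu l / (θ * ε)))
    (hslack : (∑ l, mu l * ((u l / (1 + 2 * mu l)) ^ 2
        - ∑ k, Real.exp (lam k / (θ * ε)) * Real.exp (-(C k l) / ε)
            * Real.exp (mu l / (θ * ε)))) = 0) :
    ∀ h : Fin n → ℝ,
      (θ : EReal) * Sreg C ε h₀ (fun i => u i / (1 + 2 * mu i))
          + (((1 / 2) * ∑ i, (u i - u i / (1 + 2 * mu i)) ^ 2 : ℝ) : EReal)
        ≤ (θ : EReal) * Sreg C ε h₀ h + (((1 / 2) * ∑ i, (u i - h i) ^ 2 : ℝ) : EReal) := by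
  intro h
  set g : Fin n → ℝ := fun i => u i / (1 + 2 * mu i)
  obtain ⟨N, hN⟩ : ∃ N : Matrix (Fin n) (Fin n) ℝ, ∀ k l, N k l =
      Real.exp (lam k / (θ * ε)) * Real.exp (-(C k l) / ε) * Real.exp (mu l / (θ * ε)) :=
    ⟨fun _ _ => _, fun _ _ => rfl⟩
  simp only [← hN] at hrow hcol hslack
  have hNpos : ∀ k l, 0 < N k l := fun k l => by rw [hN]; positivity
  have hlog : ∀ k l, C k l + ε * Real.log (N k l) = lam k / θ + mu l / θ := fun k l => by
    rw [hN, ← Real.exp_add, ← Real.exp_add, Real.log_exp]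
    field_simp
    ring
  have hNfeas : N ∈ otFeas h₀ g := ⟨fun k l => (hNpos k l).le, hrow, hcol⟩
  have hupper : Sreg C ε h₀ g ≤ (otObj C ε N : EReal) := sInf_le ⟨N, hNfeas, rfl⟩
  set d : ℝ := ∑ l, mu l * (h l ^ 2 - g l ^ 2) with hd
  have hlower : ((otObj C ε N + d / θ : ℝ) : EReal) ≤ Sreg C ε h₀ h := by
    refine le_sInf ?_
    rintro _ ⟨M, ⟨hM0, hMrow, hMcol⟩, rfl⟩
    refine EReal.coe_le_coe_iff.2 (le_trans ?_ (otObj_add_le hε _ _ hNpos hlog hM0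
      fun k => (hMrow k).trans (hrow k).symm))
    have hdle : d ≤ ∑ l, mu l * (∑ k, M k l - ∑ k, N k l) := by
      have hsplit : d = ∑ l, mu l * (h l ^ 2 - ∑ k, N k l) := by
        rw [hd, ← sub_eq_zero, ← Finset.sum_sub_distrib, ← neg_eq_zero, ← Finset.sum_neg_distrib,
          ← hslack]
        exact Finset.sum_congr rfl fun l _ => by ring
      rw [hsplit]
      exact Finset.sum_le_sum fun l _ =>
        mul_le_mul_of_nonneg_left (sub_le_sub_right (hMcol l) _) (hmu l)
    have hdiv := div_le_div_of_nonneg_right hdle hθ.le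
    rw [Finset.sum_div Finset.univ fun l => mu l * (∑ k, M k l - ∑ k, N k l)] at hdiv
    simpa only [div_mul_eq_mul_div, add_le_add_iff_left] using hdiv
  have hquad : 1 / 2 * ∑ i, (u i - g i) ^ 2 ≤ d + 1 / 2 * ∑ i, (u i - h i) ^ 2 := by
    rw [hd, Finset.mul_sum, Finset.mul_sum, ← Finset.sum_add_distrib]
    exact Finset.sum_le_sum fun i _ => by linarith [penalized_sq_le (hmu i) (u i) (h i)]
  have hθ' : (0 : EReal) ≤ (θ : EReal) := EReal.coe_nonneg.2 hθ.le
  calc (θ : EReal) * Sreg C ε h₀ g + ((1 / 2 * ∑ i, (u i - g i) ^ 2 : ℝ) : EReal)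
      ≤ (θ : EReal) * (otObj C ε N : EReal) + ((1 / 2 * ∑ i, (u i - g i) ^ 2 : ℝ) : EReal) :=
        add_le_add_left (mul_le_mul_of_nonneg_left hupper hθ') _
    _ ≤ (θ : EReal) * ((otObj C ε N + d / θ : ℝ) : EReal)
          + ((1 / 2 * ∑ i, (u i - h i) ^ 2 : ℝ) : EReal) := by
        rw [← EReal.coe_mul, ← EReal.coe_mul, ← EReal.coe_add, ← EReal.coe_add,
          EReal.coe_le_coe_iff, mul_add, mul_div_cancel₀ d hθ.ne']
        linarith
    _ ≤ _ := add_le_add_left (mul_le_mul_of_nonneg_left hlower hθ') _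
end
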